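/- Let l>0 and let u be the vortex map on B_l. There exists a sequence (u_k) of Lipschitz maps from B_l into the unit circle S¹ ⊂ ℝ² such that u_k → u in L¹(B_l,ℝ²) and lim_{k→∞} 𝒜(u_k, B_l) = ∫_{B_l} √(1+|∇u|²) dx + 2πl. -/

import Mathlib

open MeasureTheory Filter Metric Set
open scoped ENNReal Topology Real

noncomputable section

/-- Squared Frobenius norm of the Jacobian matrix of `v` at `z`. -/
def gradSq (v : ℂ → ℂ) (z : ℂ) : ℝ :=
  ‖fderiv ℝ v z 1‖ ^ 2 + ‖fderiv ℝ v z Complex.I‖ ^ 2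

/-- Jacobian determinant of `v` at `z`. -/
def jacDet (v : ℂ → ℂ) (z : ℂ) : ℝ :=
  LinearMap.det ((fderiv ℝ v z).toLinearMap)

/-- Area functional `𝒜(v,A) = ∫_A √(1 + |∇v|² + (det ∇v)²)`. -/
def areaFun (v : ℂ → ℂ) (A : Set ℂ) : ℝ :=
  ∫ z in A, Real.sqrt (1 + gradSq v z + jacDet v z ^ 2)

/-- The polar image of the disc of radius `l` minus the slit. -/
def polarRect (l : ℝ) : Set (ℝ × ℝ) := Ioo 0 l ×ˢ Ioo (-π) π

/-- The odd function on `[-π, π]` equal to `t` near `0` and of slope `-n` near `±π`. -/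
def tent (n t : ℝ) : ℝ := max (min t (n * (π - t))) (-(n * (π + t)))

/-- The cut-off phase of the approximating maps. -/
def phase (n : ℝ) (z : ℂ) : ℝ := min 1 (n * ‖z‖) * tent n (Complex.arg z)

/-- The circle-valued approximation of the vortex map. -/
def approxVortex (n : ℝ) (z : ℂ) : ℂ := Complex.exp (Complex.I * phase n z)

lemma tent_pi {n : ℝ} (hn : 0 ≤ n) : tent n π = 0 := by
  have := mul_nonneg hn Real.pi_pos.le
  have h : -(n * (π + π)) ≤ 0 := by linarith
  rw [tent, sub_self, mul_zero, min_eq_right Real.pi_pos.le, max_eq_left h]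

lemma tent_neg_pi {n : ℝ} (hn : 0 ≤ n) : tent n (-π) = 0 := by
  have := mul_nonneg hn Real.pi_pos.le
  have h : -π ≤ n * (π - -π) := by linarith [Real.pi_pos]
  rw [tent, add_neg_cancel, mul_zero, neg_zero, min_eq_left h, max_eq_right (by linarith [Real.pi_pos])]

lemma abs_tent_le {n t : ℝ} (hn : 0 ≤ n) (ht : t ∈ Icc (-π) π) : |tent n t| ≤ π := by
  have h1 := mul_nonneg hn (sub_nonneg.2 ht.2)
  have h2 : 0 ≤ n * (π + t) := mul_nonneg hn (by linarith [ht.1])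
  rw [abs_le, tent]
  exact ⟨le_max_of_le_left (le_min ht.1 (by linarith [Real.pi_pos])),
    max_le (min_le_of_left_le ht.2) (by linarith [Real.pi_pos])⟩

lemma abs_tent_sub_le {n : ℝ} (hn : 1 ≤ n) (s t : ℝ) : |tent n s - tent n t| ≤ n * |s - t| := by
  have h0 : 0 ≤ n := by linarith
  refine (abs_max_sub_max_le_max _ _ _ _).trans (max_le ?_ ?_)
  · refine (abs_min_sub_min_le_max _ _ _ _).trans (max_le ?_ ?_)
    · nlinarith [abs_nonneg (s - t)]
    · rw [← mul_sub, abs_mul, abs_of_nonneg h0, show π - s - (π - t) = -(s - t) by ring, abs_neg]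
  · rw [show -(n * (π + s)) - -(n * (π + t)) = n * -(s - t) by ring, abs_mul, abs_of_nonneg h0,
      abs_neg]

lemma norm_exp_sub_exp (s t : ℝ) :
    ‖Complex.exp (Complex.I * s) - Complex.exp (Complex.I * t)‖ = 2 * |Real.sin ((s - t) / 2)| := by
  have : Complex.exp (Complex.I * s) - Complex.exp (Complex.I * t) =
      Complex.exp (Complex.I * t) * (Complex.exp (Complex.I * ((s - t : ℝ) : ℂ)) - 1) := by
    rw [mul_sub, ← Complex.exp_add]
    push_cast
    ring_nf
  rw [this, norm_mul, Complex.norm_exp_I_mul_ofReal_sub_one, mul_comm Complex.I,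
    Complex.norm_exp_ofReal_mul_I]
  simp

lemma abs_tent_sub_le_norm_exp {n s t : ℝ} (hn : 1 ≤ n) (hs : s ∈ Icc (-π) π)
    (ht : t ∈ Icc (-π) π) :
    |tent n s - tent n t| ≤
      n * π / 2 * ‖Complex.exp (Complex.I * s) - Complex.exp (Complex.I * t)‖ := by
  wlog hst : t ≤ s generalizing s t
  · rw [abs_sub_comm, norm_sub_rev]
    exact this ht hs (le_of_not_ge hst)
  have hpi := Real.pi_pos
  have h0 : 0 ≤ n := by linarith
  rw [norm_exp_sub_exp]
  by_cases hd : s - t ≤ π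
  · have h1 := Real.mul_le_sin (x := (s - t) / 2) (by linarith) (by linarith)
    have h2 : s - t ≤ π * Real.sin ((s - t) / 2) := by
      calc s - t = π * (2 / π * ((s - t) / 2)) := by field_simp
        _ ≤ _ := by gcongr
    have h3 := abs_tent_sub_le hn s t
    rw [abs_of_nonneg (sub_nonneg.2 hst)] at h3
    calc _ ≤ n * (s - t) := h3
      _ ≤ n * (π * Real.sin ((s - t) / 2)) := by gcongr
      _ ≤ n * (π * |Real.sin ((s - t) / 2)|) := by gcongr; exact le_abs_self _
      _ = _ := by ring
  · push Not at hd
    have h1 := Real.mul_le_sin (x := π - (s - t) / 2) (by linarith [hs.2, ht.1]) (by linarith)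
    rw [Real.sin_pi_sub] at h1
    have h2 : 2 * π - (s - t) ≤ π * Real.sin ((s - t) / 2) := by
      calc 2 * π - (s - t) = π * (2 / π * (π - (s - t) / 2)) := by field_simp
        _ ≤ _ := by gcongr
    have h3 := abs_tent_sub_le hn s π
    have h4 := abs_tent_sub_le hn (-π) t
    rw [tent_pi h0, abs_of_nonpos (a := s - π) (by linarith [hs.2])] at h3
    rw [tent_neg_pi h0, abs_of_nonpos (a := -π - t) (by linarith [ht.1])] at h4
    calc |tent n s - tent n t| = |(tent n s - 0) + (0 - tent n t)| := by ring_nf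
      _ ≤ |tent n s - 0| + |0 - tent n t| := abs_add_le _ _
      _ ≤ n * (2 * π - (s - t)) := by linarith
      _ ≤ n * (π * Real.sin ((s - t) / 2)) := by gcongr
      _ ≤ n * (π * |Real.sin ((s - t) / 2)|) := by gcongr; exact le_abs_self _
      _ = _ := by ring

lemma norm_mul_exp_arg (z : ℂ) : (‖z‖ : ℂ) * Complex.exp (Complex.I * Complex.arg z) = z := by
  rw [mul_comm Complex.I, Complex.norm_mul_exp_arg_mul_I]

lemma norm_mul_norm_exp_arg_sub_le (z w : ℂ) :
    ‖z‖ * ‖Complex.exp (Complex.I * Complex.arg z) - Complex.exp (Complex.I * Complex.arg w)‖ ≤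
      2 * ‖z - w‖ := by
  have h : (‖z‖ : ℂ) * (Complex.exp (Complex.I * Complex.arg z) -
      Complex.exp (Complex.I * Complex.arg w)) =
      (z - w) + ((‖w‖ - ‖z‖ : ℝ) : ℂ) * Complex.exp (Complex.I * Complex.arg w) := by
    push_cast
    rw [mul_sub, sub_mul, norm_mul_exp_arg, norm_mul_exp_arg]
    ring
  calc _ = ‖(‖z‖ : ℂ) * (Complex.exp (Complex.I * Complex.arg z) -
      Complex.exp (Complex.I * Complex.arg w))‖ := by simp
    _ ≤ ‖z - w‖ + |‖w‖ - ‖z‖| * 1 := by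
      rw [h]
      refine (norm_add_le _ _).trans ?_
      rw [norm_mul, Complex.norm_real, mul_comm Complex.I, Complex.norm_exp_ofReal_mul_I,
        Real.norm_eq_abs]
    _ ≤ _ := by
      have := abs_norm_sub_norm_le w z
      rw [norm_sub_rev w z] at this
      linarith

lemma abs_phase_sub_le {n : ℝ} (hn : 1 ≤ n) (z w : ℂ) :
    |phase n z - phase n w| ≤ (n * π + n ^ 2 * π) * ‖z - w‖ := by
  have h0 : 0 ≤ n := by linarith
  have hmem : ∀ z : ℂ, Complex.arg z ∈ Icc (-π) π := fun z =>
    ⟨(Complex.neg_pi_lt_arg z).le, Complex.arg_le_pi z⟩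
  have hm0 : 0 ≤ min 1 (n * ‖z‖) := le_min zero_le_one (by positivity)
  have h1 : |min 1 (n * ‖z‖) - min 1 (n * ‖w‖)| ≤ n * ‖z - w‖ := by
    refine (abs_min_sub_min_le_max _ _ _ _).trans (max_le (by simp; positivity) ?_)
    rw [← mul_sub, abs_mul, abs_of_nonneg h0]
    gcongr
    exact abs_norm_sub_norm_le z w
  have h2 := abs_tent_sub_le_norm_exp hn (hmem z) (hmem w)
  calc |phase n z - phase n w| = |(min 1 (n * ‖z‖) - min 1 (n * ‖w‖)) * tent n (Complex.arg w) +
        min 1 (n * ‖z‖) * (tent n (Complex.arg z) - tent n (Complex.arg w))| := by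
        unfold phase; ring_nf
    _ ≤ |min 1 (n * ‖z‖) - min 1 (n * ‖w‖)| * |tent n (Complex.arg w)| +
        min 1 (n * ‖z‖) * |tent n (Complex.arg z) - tent n (Complex.arg w)| := by
        refine (abs_add_le _ _).trans ?_
        rw [abs_mul, abs_mul, abs_of_nonneg hm0]
    _ ≤ (n * ‖z - w‖) * π + (n * ‖z‖) * (n * π / 2 *
        ‖Complex.exp (Complex.I * Complex.arg z) - Complex.exp (Complex.I * Complex.arg w)‖) := by
        gcongr
        · exact abs_tent_le h0 (hmem w)
        · exact min_le_right _ _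
    _ = (n * ‖z - w‖) * π + n ^ 2 * π / 2 * (‖z‖ *
        ‖Complex.exp (Complex.I * Complex.arg z) - Complex.exp (Complex.I * Complex.arg w)‖) := by
        ring
    _ ≤ (n * ‖z - w‖) * π + n ^ 2 * π / 2 * (2 * ‖z - w‖) := by
        gcongr _ + _ * ?_
        exact norm_mul_norm_exp_arg_sub_le z w
    _ = _ := by ring

lemma lipschitzWith_approxVortex {n : ℝ} (hn : 1 ≤ n) :
    LipschitzWith (Real.toNNReal (n * π + n ^ 2 * π)) (approxVortex n) := by
  refine LipschitzWith.of_dist_le_mul fun z w => ?_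
  have h0 : 0 ≤ n := by linarith
  rw [Real.coe_toNNReal _ (by positivity), dist_eq_norm, dist_eq_norm, approxVortex, approxVortex,
    norm_exp_sub_exp]
  refine le_trans ?_ (abs_phase_sub_le hn z w)
  have := Real.abs_sin_le_abs (x := (phase n z - phase n w) / 2)
  rw [abs_div, abs_two] at this
  linarith

lemma norm_approxVortex (n : ℝ) (z : ℂ) : ‖approxVortex n z‖ = 1 := by
  rw [approxVortex, mul_comm, Complex.norm_exp_ofReal_mul_I]

/-- A circle-valued map has vanishing Jacobian determinant. -/
lemma jacDet_eq_zero_of_norm_eq_one {v : ℂ → ℂ} (hv : ∀ z, ‖v z‖ = 1) (z : ℂ) :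
    jacDet v z = 0 := by
  unfold jacDet
  by_cases hd : DifferentiableAt ℝ v z
  · by_contra hne
    have hsurj := (LinearEquiv.ofIsUnitDet (f := (fderiv ℝ v z).toLinearMap)
      (v := Complex.basisOneI) (v' := Complex.basisOneI)
      (by rw [LinearMap.det_toMatrix]; exact isUnit_iff_ne_zero.2 hne)).surjective
    obtain ⟨h, hh⟩ := hsurj (v z)
    have hh' : fderiv ℝ v z h = v z := hh
    have h1 := (hd.hasFDerivAt.norm_sq)
    have h2 : HasFDerivAt (fun x => ‖v x‖ ^ 2) (0 : ℂ →L[ℝ] ℝ) z := by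
      simp only [hv]
      exact hasFDerivAt_const _ _
    have h3 := congrArg (fun L : ℂ →L[ℝ] ℝ => L h) (h1.unique h2)
    simp [hh', hv] at h3
  · rw [fderiv_zero_of_not_differentiableAt hd]
    simp

/-- Squared gradient of a circle-valued map whose phase has separated polar variables. -/
lemma gradSq_of_polar_phase {v : ℂ → ℂ} {M H : ℝ → ℝ} {M' H' : ℝ} {z : ℂ}
    (hz : z ∈ Complex.slitPlane) (hM : HasDerivAt M M' (Real.log ‖z‖))
    (hH : HasDerivAt H H' (Complex.arg z))
    (hv : v =ᶠ[𝓝 z] fun w =>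
      Complex.exp (Complex.I * ((M (Real.log ‖w‖) * H (Complex.arg w) : ℝ) : ℂ))) :
    gradSq v z =
      ((M' * H (Complex.arg z)) ^ 2 + (M (Real.log ‖z‖) * H') ^ 2) / ‖z‖ ^ 2 := by
  have hlog : HasFDerivAt Complex.log (z⁻¹ • (1 : ℂ →L[ℝ] ℂ)) z :=
    (Complex.hasStrictDerivAt_log hz).hasDerivAt.complexToReal_fderiv
  have hre := (Complex.reCLM.hasFDerivAt).comp z hlog
  have him := (Complex.imCLM.hasFDerivAt).comp z hlog
  have hM2 := hM.comp_hasFDerivAt_of_eq z hre (by simp [Complex.log_re])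
  have hH2 := hH.comp_hasFDerivAt_of_eq z him (by simp [Complex.log_im])
  have hF := hM2.mul hH2
  have hE := ((Complex.ofRealCLM.hasFDerivAt.comp z hF).const_mul Complex.I).cexp
  have hfd := (hE.congr_of_eventuallyEq (hv.trans (.of_forall fun w => by
    simp [Complex.log_re, Complex.log_im]))).fderiv
  have hval : ∀ h : ℂ, ‖fderiv ℝ v z h‖ ^ 2 =
      (M (Real.log ‖z‖) * H' * (z⁻¹ * h).im + H (Complex.arg z) * M' * (z⁻¹ * h).re) ^ 2 := by
    intro h
    rw [hfd]
    simp only [smul_apply, Function.comp_apply, smul_eq_mul, norm_mul, Complex.norm_I,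
      ContinuousLinearMap.comp_apply, Complex.ofRealCLM_apply, Complex.norm_real]
    rw [mul_comm Complex.I, Complex.norm_exp_ofReal_mul_I, one_mul, one_mul, Real.norm_eq_abs,
      sq_abs]
    simp [Complex.log_re, Complex.log_im, mul_assoc]
  have hsq : ‖z‖⁻¹ ^ 2 = z⁻¹.re ^ 2 + z⁻¹.im ^ 2 := by
    rw [← norm_inv, Complex.sq_norm, Complex.normSq_apply]
    ring
  unfold gradSq
  rw [hval, hval, div_eq_mul_inv, ← inv_pow, hsq, mul_one, Complex.mul_I_re, Complex.mul_I_im]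
  ring

lemma setIntegral_ball_eq_polar (l : ℝ) (f : ℂ → ℝ) :
    ∫ z in ball (0 : ℂ) l, f z = ∫ p in polarRect l, p.1 * f (Complex.polarCoord.symm p) := by
  rw [← integral_indicator measurableSet_ball, ← Complex.integral_comp_polarCoord_symm,
    ← integral_indicator, ← integral_indicator]
  · congr 1
    ext p
    by_cases hp : p ∈ polarCoord.target
    · have h1 : 0 < p.1 := hp.1
      rw [indicator_of_mem hp, smul_eq_mul]
      by_cases hl : p.1 < l
      · rw [indicator_of_mem, indicator_of_mem]
        · exact ⟨⟨h1, hl⟩, hp.2⟩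
        · rwa [mem_ball_zero_iff, Complex.norm_polarCoord_symm, abs_of_pos h1]
      · rw [indicator_of_notMem, indicator_of_notMem, mul_zero]
        · exact fun h => hl h.1.2
        · rwa [mem_ball_zero_iff, Complex.norm_polarCoord_symm, abs_of_pos h1]
    · rw [indicator_of_notMem hp, indicator_of_notMem]
      exact fun h => hp ⟨h.1.1, h.2⟩
  · exact measurableSet_Ioo.prod measurableSet_Ioo
  · exact polarCoord.open_target.measurableSet

lemma norm_polar {p : ℝ × ℝ} (hp : p ∈ polarCoord.target) :
    ‖Complex.polarCoord.symm p‖ = p.1 := by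
  have h1 : 0 < p.1 := hp.1
  rw [Complex.norm_polarCoord_symm, abs_of_pos h1]

lemma arg_polar {p : ℝ × ℝ} (hp : p ∈ polarCoord.target) :
    Complex.arg (Complex.polarCoord.symm p) = p.2 := by
  rw [Complex.polarCoord_symm_apply]
  push_cast
  exact Complex.arg_mul_cos_add_sin_mul_I hp.1 ⟨hp.2.1, hp.2.2.le⟩

lemma polar_mem_slitPlane {p : ℝ × ℝ} (hp : p ∈ polarCoord.target) :
    Complex.polarCoord.symm p ∈ Complex.slitPlane :=
  Complex.polarCoord.map_target hp

lemma polarRect_subset (l : ℝ) : polarRect l ⊆ polarCoord.target :=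
  fun _ hp => ⟨hp.1.1, hp.2⟩

/-- The angle at which the slope of `tent n` changes sign. -/
def peak (n : ℝ) : ℝ := n * π / (n + 1)

lemma tent_eq_self {n t : ℝ} (hn : 1 ≤ n) (ht : |t| < peak n) : tent n t = t := by
  have h0 : 0 < n + 1 := by linarith
  rw [peak, lt_div_iff₀ h0] at ht
  have h1 : t * (n + 1) ≤ |t| * (n + 1) := by gcongr; exact le_abs_self t
  have h2 : -t * (n + 1) ≤ |t| * (n + 1) := by gcongr; exact neg_le_abs t
  rw [tent, min_eq_left (by linarith), max_eq_left (by linarith)]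

lemma tent_eq_right {n t : ℝ} (hn : 1 ≤ n) (ht : peak n < t) :
    tent n t = n * (π - t) := by
  have h0 : 0 < n + 1 := by linarith
  have := Real.pi_pos
  rw [peak, div_lt_iff₀ h0] at ht
  rw [tent, min_eq_right (by linarith), max_eq_left (by nlinarith)]

lemma tent_eq_left {n t : ℝ} (hn : 1 ≤ n) (ht : t < -peak n) :
    tent n t = -(n * (π + t)) := by
  have h0 : 0 < n + 1 := by linarith
  rw [peak, lt_neg, div_lt_iff₀ h0] at ht
  rw [tent, max_eq_right]
  exact min_le_of_left_le (by linarith)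

lemma hasDerivAt_tent {n t : ℝ} (hn : 1 ≤ n) (ht : |t| ≠ peak n) :
    ∃ σ, HasDerivAt (tent n) σ t ∧ σ ^ 2 = if |t| < peak n then 1 else n ^ 2 := by
  rcases lt_or_gt_of_ne ht with h | h
  · refine ⟨1, (hasDerivAt_id t).congr_of_eventuallyEq ?_, by simp [h]⟩
    filter_upwards [(isOpen_lt continuous_abs continuous_const).mem_nhds h] with s hs
    exact tent_eq_self hn hs
  · rcases lt_abs.1 h with h' | h'
    · refine ⟨-n, ?_, by simp [h.not_gt]⟩
      have hd : HasDerivAt (fun s => n * (π - s)) (-n) t := by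
        simpa using ((hasDerivAt_id t).const_sub π).const_mul n
      refine hd.congr_of_eventuallyEq ?_
      filter_upwards [lt_mem_nhds h'] with s hs
      exact tent_eq_right hn hs
    · refine ⟨-n, ?_, by simp [h.not_gt]⟩
      have hd : HasDerivAt (fun s => -(n * (π + s))) (-n) t := by
        simpa using (((hasDerivAt_id t).const_add π).const_mul n).fun_neg
      refine hd.congr_of_eventuallyEq ?_
      filter_upwards [gt_mem_nhds (lt_neg.1 h')] with s hs
      exact tent_eq_left hn hs

/-- The area integrand of `approxVortex n` in polar coordinates. -/
def polarDensity (n : ℝ) (p : ℝ × ℝ) : ℝ :=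
  √(p.1 ^ 2 + ((if n * p.1 < 1 then n * p.1 else 0) * tent n p.2) ^ 2 +
    min 1 (n * p.1) ^ 2 * if |p.2| < peak n then 1 else n ^ 2)

lemma hasDerivAt_min_exp {n t : ℝ} (ht : n * Real.exp t ≠ 1) :
    HasDerivAt (fun s => min 1 (n * Real.exp s))
      (if n * Real.exp t < 1 then n * Real.exp t else 0) t := by
  have hc : Continuous fun s => n * Real.exp s := by fun_prop
  rcases lt_or_gt_of_ne ht with h | h
  · rw [if_pos h]
    refine ((Real.hasDerivAt_exp t).const_mul n).congr_of_eventuallyEq ?_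
    filter_upwards [hc.continuousAt.eventually (gt_mem_nhds h)] with s hs
    exact min_eq_right (le_of_lt hs)
  · rw [if_neg h.not_gt]
    refine (hasDerivAt_const t (1 : ℝ)).congr_of_eventuallyEq ?_
    filter_upwards [hc.continuousAt.eventually (lt_mem_nhds h)] with s hs
    exact min_eq_left (le_of_lt hs)

lemma mul_sqrt_one_add_div {r a : ℝ} (hr : 0 < r) : r * √(1 + a / r ^ 2) = √(r ^ 2 + a) := by
  have : r ^ 2 + a = r ^ 2 * (1 + a / r ^ 2) := by field_simp
  rw [this, Real.sqrt_mul (sq_nonneg r), Real.sqrt_sq hr.le]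

lemma polar_density_approxVortex {n : ℝ} (hn : 1 ≤ n) {p : ℝ × ℝ} (hp : p ∈ polarCoord.target)
    (h1 : n * p.1 ≠ 1) (h2 : |p.2| ≠ peak n) :
    p.1 * √(1 + gradSq (approxVortex n) (Complex.polarCoord.symm p) +
      jacDet (approxVortex n) (Complex.polarCoord.symm p) ^ 2) = polarDensity n p := by
  have hr : 0 < p.1 := hp.1
  obtain ⟨σ, hσ, hσ2⟩ := hasDerivAt_tent hn h2
  have hexp : Real.exp (Real.log p.1) = p.1 := Real.exp_log hr
  rw [jacDet_eq_zero_of_norm_eq_one (norm_approxVortex n),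
    gradSq_of_polar_phase (polar_mem_slitPlane hp)
      (M := fun s => min 1 (n * Real.exp s)) (H := tent n)
      (M' := if n * p.1 < 1 then n * p.1 else 0) (H' := σ), norm_polar hp, arg_polar hp, hexp,
      zero_pow two_ne_zero, add_zero, mul_sqrt_one_add_div hr, polarDensity, ← hσ2, mul_pow _ σ,
      add_assoc]
  · rw [norm_polar hp]
    have := hasDerivAt_min_exp (n := n) (t := Real.log p.1) (by rwa [hexp])
    rwa [hexp] at this
  · rwa [arg_polar hp]
  · filter_upwards [Complex.isOpen_slitPlane.mem_nhds (polar_mem_slitPlane hp)] with w hw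
    rw [Real.exp_log (norm_pos_iff.2 (Complex.slitPlane_ne_zero hw))]
    rfl

lemma vortex_eq_exp_arg {u : ℂ → ℂ} (hu : ∀ z : ℂ, z ≠ 0 → u z = ‖z‖⁻¹ • z) {z : ℂ}
    (hz : z ≠ 0) : u z = Complex.exp (Complex.I * Complex.arg z) := by
  have h : (‖z‖ : ℂ) ≠ 0 := by simpa using hz
  rw [hu z hz, Complex.real_smul]
  nth_rw 2 [← norm_mul_exp_arg z]
  push_cast
  rw [inv_mul_cancel_left₀ h]

lemma polar_density_vortex {u : ℂ → ℂ} (hu : ∀ z : ℂ, z ≠ 0 → u z = ‖z‖⁻¹ • z) {p : ℝ × ℝ}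
    (hp : p ∈ polarCoord.target) :
    p.1 * √(1 + gradSq u (Complex.polarCoord.symm p)) = √(p.1 ^ 2 + 1) := by
  rw [gradSq_of_polar_phase (polar_mem_slitPlane hp) (hasDerivAt_const _ (1 : ℝ))
      (hasDerivAt_id _), norm_polar hp, mul_sqrt_one_add_div hp.1]
  · simp
  · filter_upwards [Complex.isOpen_slitPlane.mem_nhds (polar_mem_slitPlane hp)] with w hw
    rw [vortex_eq_exp_arg hu (Complex.slitPlane_ne_zero hw)]
    simp

lemma ae_generic (n : ℝ) : ∀ᵐ p : ℝ × ℝ, n * p.1 ≠ 1 ∧ |p.2| ≠ peak n := by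
  have h1 : ∀ᵐ r : ℝ, n * r ≠ 1 := by
    filter_upwards [compl_mem_ae_iff.2 (measure_singleton n⁻¹)] with r hr h
    exact hr (eq_inv_of_mul_eq_one_right h)
  have h2 : ∀ᵐ t : ℝ, |t| ≠ peak n := by
    filter_upwards [compl_mem_ae_iff.2 (measure_singleton (peak n)),
      compl_mem_ae_iff.2 (measure_singleton (-peak n))] with t ht ht' h
    rcases eq_or_eq_neg_of_abs_eq h with h | h
    exacts [ht h, ht' h]
  filter_upwards [Measure.quasiMeasurePreserving_fst.ae h1,
    Measure.quasiMeasurePreserving_snd.ae h2] with p hp hp'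
  exact ⟨hp, hp'⟩

lemma areaFun_approxVortex {n : ℝ} (hn : 1 ≤ n) (l : ℝ) :
    areaFun (approxVortex n) (ball 0 l) = ∫ p in polarRect l, polarDensity n p := by
  rw [areaFun, setIntegral_ball_eq_polar]
  refine setIntegral_congr_ae (measurableSet_Ioo.prod measurableSet_Ioo) ?_
  filter_upwards [ae_generic n] with p hp hpl
  exact polar_density_approxVortex hn (polarRect_subset l hpl) hp.1 hp.2

lemma area_vortex {u : ℂ → ℂ} (hu : ∀ z : ℂ, z ≠ 0 → u z = ‖z‖⁻¹ • z) (l : ℝ) :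
    ∫ z in ball (0 : ℂ) l, √(1 + gradSq u z) = ∫ p in polarRect l, √(p.1 ^ 2 + 1) := by
  rw [setIntegral_ball_eq_polar]
  exact setIntegral_congr_fun (measurableSet_Ioo.prod measurableSet_Ioo)
    fun p hp => polar_density_vortex hu (polarRect_subset l hp)

lemma peak_nonneg {n : ℝ} (hn : 1 ≤ n) : 0 ≤ peak n := by
  have h0 : 0 ≤ n := by linarith
  have := Real.pi_pos
  unfold peak
  positivity

lemma pi_sub_peak {n : ℝ} (hn : 1 ≤ n) : π - peak n = π / (n + 1) := by
  have h0 : n + 1 ≠ 0 := by linarith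
  unfold peak
  field_simp
  ring

lemma peak_lt_pi {n : ℝ} (hn : 1 ≤ n) : peak n < π := by
  have h0 : 0 < n + 1 := by linarith
  have h1 : 0 < π / (n + 1) := div_pos Real.pi_pos h0
  linarith [pi_sub_peak hn]

lemma tendsto_peak : Tendsto peak atTop (𝓝 π) := by
  have h : Tendsto (fun n : ℝ => π - π / (n + 1)) atTop (𝓝 (π - 0)) :=
    tendsto_const_nhds.sub
      (tendsto_const_nhds.div_atTop (tendsto_atTop_add_const_right _ _ tendsto_id))
  rw [sub_zero] at h
  refine h.congr' ?_
  filter_upwards [eventually_ge_atTop 1] with n hn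
  rw [← pi_sub_peak hn, sub_sub_cancel]

lemma measurable_tent (n : ℝ) : Measurable (tent n) := by
  unfold tent
  fun_prop

lemma measurable_polarDensity (n : ℝ) : Measurable (polarDensity n) := by
  have h1 : Measurable fun p : ℝ × ℝ => if n * p.1 < 1 then n * p.1 else 0 :=
    Measurable.ite (measurableSet_lt (by fun_prop) measurable_const) (by fun_prop)
      measurable_const
  have h2 : Measurable fun p : ℝ × ℝ => if |p.2| < peak n then (1 : ℝ) else n ^ 2 :=
    Measurable.ite (measurableSet_lt (by fun_prop) measurable_const) measurable_const
      measurable_const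
  have h3 : Measurable fun p : ℝ × ℝ => tent n p.2 := (measurable_tent n).comp measurable_snd
  unfold polarDensity
  fun_prop

lemma polarDensity_nonneg (n : ℝ) (p : ℝ × ℝ) : 0 ≤ polarDensity n p := Real.sqrt_nonneg _

lemma polarDensity_le {n l : ℝ} (hn : 1 ≤ n) {p : ℝ × ℝ} (hp : p ∈ polarRect l) :
    polarDensity n p ≤ l + π + if |p.2| < peak n then 1 else n := by
  obtain ⟨⟨hr, hrl⟩, ht⟩ := hp
  have h0 : 0 < n := by linarith
  have hnr : 0 < n * p.1 := mul_pos h0 hr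
  have hpi := Real.pi_pos
  have h1 : ((if n * p.1 < 1 then n * p.1 else 0) * tent n p.2) ^ 2 ≤ π ^ 2 := by
    rw [← sq_abs, abs_mul]
    gcongr
    rw [← one_mul π]
    gcongr
    · split_ifs with h
      · rw [abs_of_pos hnr]; exact h.le
      · simp
    · exact abs_tent_le h0.le ⟨ht.1.le, ht.2.le⟩
  have h2 : (if |p.2| < peak n then 1 else n ^ 2 : ℝ) =
      (if |p.2| < peak n then 1 else n) ^ 2 := by split_ifs <;> simp
  have h3 : (0 : ℝ) ≤ if |p.2| < peak n then 1 else n := by split_ifs <;> linarith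
  have h4 : min 1 (n * p.1) ^ 2 ≤ 1 :=
    pow_le_one₀ (le_min zero_le_one hnr.le) (min_le_left _ _)
  have h5 : p.1 ^ 2 ≤ l ^ 2 := by gcongr
  unfold polarDensity
  rw [h2]
  generalize (if |p.2| < peak n then 1 else n : ℝ) = σ at *
  have hl : 0 < l := hr.trans hrl
  refine Real.sqrt_le_iff.2 ⟨by positivity, ?_⟩
  have h6 : min 1 (n * p.1) ^ 2 * σ ^ 2 ≤ 1 * σ ^ 2 := by gcongr
  nlinarith [mul_nonneg hl.le h3, mul_nonneg hpi.le h3, mul_nonneg hl.le hpi.le]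

lemma le_polarDensity {n : ℝ} {p : ℝ × ℝ} (h1 : 1 ≤ n * p.1)
    (h2 : peak n ≤ |p.2|) : n ≤ polarDensity n p := by
  rw [polarDensity, if_neg h1.not_gt, if_neg h2.not_gt, min_eq_left h1]
  refine Real.le_sqrt_of_sq_le ?_
  nlinarith [sq_nonneg p.1]

lemma polarDensity_eq {n : ℝ} {p : ℝ × ℝ} (h1 : 1 ≤ n * p.1) (h2 : |p.2| < peak n) :
    polarDensity n p = √(p.1 ^ 2 + 1) := by
  rw [polarDensity, if_neg h1.not_gt, if_pos h2, min_eq_left h1]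
  simp

lemma eventually_generic {l : ℝ} {p : ℝ × ℝ} (hp : p ∈ polarRect l) :
    ∀ᶠ n : ℝ in atTop, 1 ≤ n ∧ 1 ≤ n * p.1 ∧ |p.2| < peak n := by
  filter_upwards [eventually_ge_atTop 1,
    (tendsto_id.atTop_mul_const hp.1.1).eventually (eventually_ge_atTop 1),
    tendsto_peak.eventually (lt_mem_nhds (abs_lt.2 hp.2))] with n h1 h2 h3
  exact ⟨h1, h2, h3⟩

lemma measurableSet_polarRect (l : ℝ) : MeasurableSet (polarRect l) :=
  measurableSet_Ioo.prod measurableSet_Ioo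

lemma volume_polarRect_lt_top (l : ℝ) : volume (polarRect l) < ∞ := by
  rw [polarRect, Measure.volume_eq_prod, Measure.prod_prod]
  exact ENNReal.mul_lt_top measure_Ioo_lt_top measure_Ioo_lt_top

lemma measurableSet_abs_snd_lt (a : ℝ) : MeasurableSet {p : ℝ × ℝ | |p.2| < a} :=
  measurableSet_lt (by fun_prop) measurable_const

lemma integrableOn_polarDensity {n : ℝ} (hn : 1 ≤ n) (l : ℝ) :
    IntegrableOn (polarDensity n) (polarRect l) := by
  refine IntegrableOn.of_bound (volume_polarRect_lt_top l)
    (measurable_polarDensity n).aestronglyMeasurable (l + π + n) ?_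
  refine (ae_restrict_iff' (measurableSet_polarRect l)).2 (.of_forall fun p hp => ?_)
  rw [Real.norm_of_nonneg (polarDensity_nonneg n p)]
  refine (polarDensity_le hn hp).trans ?_
  gcongr
  split_ifs <;> linarith

lemma tendsto_integral_polarDensity_inter (l : ℝ) {N : ℕ → ℝ} (hN : ∀ k, 1 ≤ N k)
    (hlim : Tendsto N atTop atTop) :
    Tendsto (fun k => ∫ p in polarRect l ∩ {p | |p.2| < peak (N k)}, polarDensity (N k) p) atTop
      (𝓝 (∫ p in polarRect l, √(p.1 ^ 2 + 1))) := by
  simp_rw [← setIntegral_indicator (measurableSet_abs_snd_lt _)]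
  have : IsFiniteMeasure (volume.restrict (polarRect l)) :=
    isFiniteMeasure_restrict.2 (volume_polarRect_lt_top l).ne
  refine tendsto_integral_of_dominated_convergence (fun _ => l + π + 1)
    (fun k => ((measurable_polarDensity _).indicator
      (measurableSet_abs_snd_lt _)).aestronglyMeasurable) (integrable_const _) (fun k => ?_) ?_
  · refine (ae_restrict_iff' (measurableSet_polarRect l)).2 (.of_forall fun p hp => ?_)
    by_cases h : |p.2| < peak (N k)
    · rw [indicator_of_mem (by exact h), Real.norm_of_nonneg (polarDensity_nonneg _ p)]
      simpa [h] using polarDensity_le (hN k) hp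
    · rw [indicator_of_notMem (by exact h), norm_zero]
      linarith [Real.pi_pos, hp.1.1, hp.1.2]
  · refine (ae_restrict_iff' (measurableSet_polarRect l)).2 (.of_forall fun p hp => ?_)
    refine tendsto_const_nhds.congr' ?_
    filter_upwards [hlim.eventually (eventually_generic hp)] with k hk
    rw [indicator_of_mem (by exact hk.2.2), polarDensity_eq hk.2.1 hk.2.2]

lemma polarRect_diff (l a : ℝ) : polarRect l \ {p | |p.2| < a} =
    Ioo 0 l ×ˢ (Ioo (-π) π \ Ioo (-a) a) := by
  ext p
  simp only [polarRect, Set.mem_sdiff, mem_prod, mem_ofPred_eq, abs_lt, mem_Ioo]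
  tauto

lemma volume_real_Ioo_prod {n : ℝ} (hn : 1 ≤ n) (a b : ℝ) :
    volume.real (Ioo a b ×ˢ (Ioo (-π) π \ Ioo (-peak n) (peak n))) =
      max (b - a) 0 * (2 * π / (n + 1)) := by
  have h := pi_sub_peak hn
  have h1 := peak_lt_pi hn
  have h2 := peak_nonneg hn
  rw [Measure.volume_eq_prod, measureReal_prod_prod, Real.volume_real_Ioo,
    measureReal_sdiff (Ioo_subset_Ioo (by linarith) h1.le) measurableSet_Ioo
      measure_Ioo_lt_top.ne,
    Real.volume_real_Ioo_of_le (by linarith), Real.volume_real_Ioo_of_le (by linarith)]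
  congr 1
  linear_combination 2 * h

lemma integral_polarDensity_diff_le {l n : ℝ} (hl : 0 < l) (hn : 1 ≤ n) :
    ∫ p in polarRect l \ {p | |p.2| < peak n}, polarDensity n p ≤
      (l + π + n) * (l * (2 * π / (n + 1))) := by
  have hfin : volume (polarRect l \ {p | |p.2| < peak n}) < ∞ :=
    (measure_mono sdiff_subset).trans_lt (volume_polarRect_lt_top l)
  have h := norm_setIntegral_le_of_norm_le_const (f := polarDensity n) (C := l + π + n) hfin
    (fun p hp => by
      have := polarDensity_le hn hp.1
      rw [if_neg (show ¬|p.2| < peak n from hp.2)] at this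
      rwa [Real.norm_of_nonneg (polarDensity_nonneg n p)])
  rw [polarRect_diff, volume_real_Ioo_prod hn, sub_zero, max_eq_left hl.le,
    ← polarRect_diff] at h
  exact (le_abs_self _).trans h

lemma le_integral_polarDensity_diff {l n : ℝ} (hn : 1 ≤ n) :
    n * ((l - n⁻¹) * (2 * π / (n + 1))) ≤
      ∫ p in polarRect l \ {p | |p.2| < peak n}, polarDensity n p := by
  have h0 : 0 < n := by linarith
  have hpi := Real.pi_pos
  have hint : IntegrableOn (polarDensity n) (polarRect l \ {p | |p.2| < peak n}) :=
    (integrableOn_polarDensity hn l).mono_set sdiff_subset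
  rw [polarRect_diff] at hint ⊢
  set T := Ioo (-π) π \ Ioo (-peak n) (peak n) with hT
  have hTm : MeasurableSet T := measurableSet_Ioo.diff measurableSet_Ioo
  have hsub : Ioo n⁻¹ l ×ˢ T ⊆ Ioo 0 l ×ˢ T :=
    prod_mono (Ioo_subset_Ioo_left (inv_nonneg.2 h0.le)) subset_rfl
  have hvol := volume_real_Ioo_prod hn n⁻¹ l
  calc n * ((l - n⁻¹) * (2 * π / (n + 1)))
      ≤ n * volume.real (Ioo n⁻¹ l ×ˢ T) := by
        rw [hvol]
        gcongr
        exact le_max_left _ _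
    _ ≤ ∫ p in Ioo n⁻¹ l ×ˢ T, polarDensity n p := by
        refine setIntegral_ge_of_const_le_real (measurableSet_Ioo.prod hTm) ?_ (fun p hp => ?_)
          (hint.mono_set hsub)
        · refine ne_top_of_le_ne_top (volume_polarRect_lt_top l).ne (measure_mono ?_)
          exact hsub.trans (prod_mono subset_rfl sdiff_subset)
        · refine le_polarDensity ?_ ?_
          · have := hp.1.1
            rw [inv_lt_iff_one_lt_mul₀' h0] at this
            exact this.le
          · exact not_lt.1 fun h => hp.2.2 (abs_lt.1 h)
    _ ≤ _ := setIntegral_mono_set hint (.of_forall fun p => polarDensity_nonneg n p)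
        hsub.eventuallyLE

lemma tendsto_integral_polarDensity_diff {l : ℝ} (hl : 0 < l) :
    Tendsto (fun n => ∫ p in polarRect l \ {p | |p.2| < peak n}, polarDensity n p) atTop
      (𝓝 (2 * π * l)) := by
  have h1 : Tendsto (fun n : ℝ => (n + 1)⁻¹) atTop (𝓝 0) :=
    tendsto_inv_atTop_zero.comp (tendsto_atTop_add_const_right _ _ tendsto_id)
  have hup : Tendsto (fun n : ℝ => 2 * π * l * (1 + (l + π - 1) * (n + 1)⁻¹)) atTop
      (𝓝 (2 * π * l * (1 + (l + π - 1) * 0))) :=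
    (((h1.const_mul _).const_add _).const_mul _)
  have hlo : Tendsto (fun n : ℝ => 2 * π * (l - (l + 1) * (n + 1)⁻¹)) atTop
      (𝓝 (2 * π * (l - (l + 1) * 0))) :=
    (((h1.const_mul _).const_sub _).const_mul _)
  rw [mul_zero, add_zero, mul_one] at hup
  rw [mul_zero, sub_zero] at hlo
  refine tendsto_of_tendsto_of_tendsto_of_le_of_le' hlo hup ?_ ?_
  · filter_upwards [eventually_ge_atTop 1] with n hn
    refine le_trans (le_of_eq ?_) (le_integral_polarDensity_diff hn)
    have : n ≠ 0 := by linarith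
    have : n + 1 ≠ 0 := by linarith
    field_simp
    ring
  · filter_upwards [eventually_ge_atTop 1] with n hn
    refine (integral_polarDensity_diff_le hl hn).trans (le_of_eq ?_)
    have : n + 1 ≠ 0 := by linarith
    field_simp
    ring

lemma measurable_approxVortex {n : ℝ} (hn : 1 ≤ n) : Measurable (approxVortex n) :=
  (lipschitzWith_approxVortex hn).continuous.measurable

lemma approxVortex_polar {n : ℝ} (hn : 1 ≤ n) {p : ℝ × ℝ} (hp : p ∈ polarCoord.target)
    (h1 : 1 ≤ n * p.1) (h2 : |p.2| < peak n) :
    approxVortex n (Complex.polarCoord.symm p) = Complex.exp (Complex.I * p.2) := by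
  rw [approxVortex, phase, norm_polar hp, arg_polar hp, min_eq_left h1, one_mul,
    tent_eq_self hn h2]

lemma tendsto_integral_norm_approxVortex_sub {l : ℝ} {u : ℂ → ℂ}
    (hu : ∀ z : ℂ, z ≠ 0 → u z = ‖z‖⁻¹ • z) {N : ℕ → ℝ} (hN : ∀ k, 1 ≤ N k)
    (hlim : Tendsto N atTop atTop) :
    Tendsto (fun k => ∫ z in ball (0 : ℂ) l, ‖approxVortex (N k) z - u z‖) atTop (𝓝 0) := by
  have hcongr : ∀ k, ∫ z in ball (0 : ℂ) l, ‖approxVortex (N k) z - u z‖ =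
      ∫ p in polarRect l, p.1 * ‖approxVortex (N k) (Complex.polarCoord.symm p) -
        Complex.exp (Complex.I * p.2)‖ := by
    intro k
    rw [setIntegral_ball_eq_polar]
    refine setIntegral_congr_fun (measurableSet_polarRect l) fun p hp => ?_
    have hp' := polarRect_subset l hp
    rw [vortex_eq_exp_arg hu (Complex.slitPlane_ne_zero (polar_mem_slitPlane hp')), arg_polar hp']
  simp_rw [hcongr]
  have : IsFiniteMeasure (volume.restrict (polarRect l)) :=
    isFiniteMeasure_restrict.2 (volume_polarRect_lt_top l).ne
  rw [← integral_zero (ℝ × ℝ) ℝ (μ := volume.restrict (polarRect l))]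
  refine tendsto_integral_of_dominated_convergence (fun _ => l * 2) (fun k => ?_)
    (integrable_const _) (fun k => ?_) ?_
  · have hsymm : Measurable fun p : ℝ × ℝ => Complex.polarCoord.symm p := by
      simp only [Complex.polarCoord_symm_apply]
      fun_prop
    have := (measurable_approxVortex (hN k)).comp hsymm
    exact (measurable_fst.mul (this.sub (by fun_prop)).norm).aestronglyMeasurable
  · refine (ae_restrict_iff' (measurableSet_polarRect l)).2 (.of_forall fun p hp => ?_)
    rw [norm_mul, norm_norm, Real.norm_of_nonneg hp.1.1.le]
    refine mul_le_mul hp.1.2.le ?_ (norm_nonneg _) (hp.1.1.trans hp.1.2).le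
    refine (norm_sub_le _ _).trans ?_
    rw [norm_approxVortex, mul_comm Complex.I, Complex.norm_exp_ofReal_mul_I]
    norm_num
  · refine (ae_restrict_iff' (measurableSet_polarRect l)).2 (.of_forall fun p hp => ?_)
    refine tendsto_const_nhds.congr' ?_
    filter_upwards [hlim.eventually (eventually_generic hp)] with k hk
    rw [approxVortex_polar hk.1 (polarRect_subset l hp) hk.2.1 hk.2.2, sub_self, norm_zero,
      mul_zero]

/-- existence of a sequence of circle-valued Lipschitz maps
converging to the vortex map whose graph areas converge to
`∫ √(1+|∇u|²) + 2πl` (the cylinder construction). -/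
theorem cylinder_sequence
    (l : ℝ) (hl : 0 < l) (u : ℂ → ℂ)
    (hu : ∀ z : ℂ, z ≠ 0 → u z = ‖z‖⁻¹ • z) :
    ∃ (uk : ℕ → ℂ → ℂ) (K : ℕ → NNReal),
      (∀ k, LipschitzOnWith (K k) (uk k) (ball 0 l)) ∧
      (∀ k, ∀ z ∈ ball (0 : ℂ) l, ‖uk k z‖ = 1) ∧
      Tendsto (fun k => ∫ z in ball (0 : ℂ) l, ‖uk k z - u z‖) atTop (nhds 0) ∧
      Tendsto (fun k => areaFun (uk k) (ball 0 l)) atTop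
        (nhds ((∫ z in ball (0 : ℂ) l, Real.sqrt (1 + gradSq u z)) +
          2 * Real.pi * l)) := by
  have hN : ∀ k : ℕ, (1 : ℝ) ≤ (k : ℝ) + 1 := fun k => by simp
  have hlim : Tendsto (fun k : ℕ => (k : ℝ) + 1) atTop atTop :=
    tendsto_atTop_add_const_right _ _ tendsto_natCast_atTop_atTop
  refine ⟨fun k => approxVortex (k + 1), _,
    fun k => (lipschitzWith_approxVortex (hN k)).lipschitzOnWith,
    fun k z _ => norm_approxVortex _ z, tendsto_integral_norm_approxVortex_sub hu hN hlim, ?_⟩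
  rw [area_vortex hu]
  refine ((tendsto_integral_polarDensity_inter l hN hlim).add
    ((tendsto_integral_polarDensity_diff hl).comp hlim)).congr fun k => ?_
  rw [areaFun_approxVortex (hN k)]
  exact integral_inter_add_sdiff (measurableSet_abs_snd_lt _) (integrableOn_polarDensity (hN k) l)
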